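/- Define φ(ξ,κ) = ∑_{(z,n)∈S} n·π(ξ,κ)(z,n), where π(ξ,κ) is the unique probability solution of the balance equations for (ξ,κ). Then φ is jointly and uniformly continuous on the set of Markovian strategies (with sup-norm) times the interval [β·λ·(1−γ), β·λ]: for every ε > 0 there exists δ > 0 such that for all Markovian strategies ξ₁, ξ₂ and all κ₁, κ₂ ∈ [β·λ·(1−γ), β·λ], if sup_{(z,n)∈S} |ξ₁(z,n) − ξ₂(z,n)| < δ and |κ₁ − κ₂| < δ, then |φ(ξ₁,κ₁) − φ(ξ₂,κ₂)| < ε. -/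

import Mathlib

open scoped BigOperators

variable {Z : Type}

/-- A Markovian strategy `ξ : S → [0,1]` on the state space `S = Z × ℕ`. -/
def IsStrategy (ξ : Z → ℕ → ℝ) : Prop := ∀ z n, 0 ≤ ξ z n ∧ ξ z n ≤ 1

/-- The balance (stationarity) equations for the single-location chain `MC(ξ, κ)`. -/
def Balance [Fintype Z] [DecidableEq Z] (μ : Z → Z → ℝ) (lam γ κ : ℝ)
    (ξ : Z → ℕ → ℝ) (π : Z → ℕ → ℝ) : Prop :=
  ∀ x : Z, ∀ m : ℕ,
    π x m * ((∑ y ∈ Finset.univ.filter (fun y => y ≠ x), μ x y) + κ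
        + lam * m * (1 - γ * ξ x m))
      = (∑ z ∈ Finset.univ.filter (fun z => z ≠ x), π z m * μ z x)
        + κ * (if 1 ≤ m then π x (m - 1) else 0)
        + lam * (m + 1) * (1 - γ * ξ x (m + 1)) * π x (m + 1)

/-- A probability solution of the balance equations for `(ξ, κ)`. -/
def IsProbSolution [Fintype Z] [DecidableEq Z] (μ : Z → Z → ℝ) (lam γ κ : ℝ)
    (ξ : Z → ℕ → ℝ) (π : Z → ℕ → ℝ) : Prop :=
  (∀ z n, 0 ≤ π z n) ∧ Summable (fun p : Z × ℕ => π p.1 p.2) ∧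
    (∑' p : Z × ℕ, π p.1 p.2) = 1 ∧ Balance μ lam γ κ ξ π

/-- A resource-sharing function: nonnegative, positive somewhere (with `n ≥ 1`),
and tending to `0` as the number of agents grows. -/
def IsResourceSharing (F : Z → ℕ → ℝ) : Prop :=
  (∀ z n, 0 ≤ F z n) ∧ (∃ z₀ n₀, 1 ≤ n₀ ∧ 0 < F z₀ n₀) ∧
    ∀ z, Filter.Tendsto (fun n => F z n) Filter.atTop (nhds 0)

/-- A value-function pair `(V, V_st)` for `(ξ, κ, V_sw)`: the Bellman equations. -/
def IsValuePair [Fintype Z] [DecidableEq Z] (μ : Z → Z → ℝ) (lam γ κ V_sw : ℝ)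
    (F ξ : Z → ℕ → ℝ) (V V_st : Z → ℕ → ℝ) : Prop :=
  (∃ M, ∀ z n, |V z n| ≤ M) ∧ (∃ M, ∀ z n, |V_st z n| ≤ M) ∧
    ∀ z : Z, ∀ n : ℕ, 1 ≤ n →
      V z n = F z n + γ * max (V_st z n) V_sw ∧
      ((n : ℝ) * lam + κ + ∑ y ∈ Finset.univ.filter (fun y => y ≠ z), μ z y) * V_st z n
        = lam * V z n + κ * V_st z (n + 1)
          + (∑ w ∈ Finset.univ.filter (fun w => w ≠ z), μ z w * V_st w n)
          + ((n : ℝ) - 1) * lam * (1 - γ * ξ z n) * V_st z (n - 1)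
          + ((n : ℝ) - 1) * lam * γ * ξ z n * V_st z n

/-- A mean field equilibrium `(ξ, κ, V_sw, π, V, V_st)`. -/
def IsMFE [Fintype Z] [DecidableEq Z] (μ : Z → Z → ℝ) (lam γ β : ℝ) (F : Z → ℕ → ℝ)
    (ξ : Z → ℕ → ℝ) (κ V_sw : ℝ) (π V V_st : Z → ℕ → ℝ) : Prop :=
  IsStrategy ξ ∧ 0 < κ ∧ 0 < V_sw ∧
    IsProbSolution μ lam γ κ ξ π ∧
    IsValuePair μ lam γ κ V_sw F ξ V V_st ∧
    (∀ z : Z, ∀ n : ℕ, 1 ≤ n →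
      (V_sw < V_st z n → ξ z n = 1) ∧ (V_st z n < V_sw → ξ z n = 0)) ∧
    V_sw = (∑' p : Z × ℕ, π p.1 p.2 * V_st p.1 (p.2 + 1)) ∧
    (∑' p : Z × ℕ, (p.2 : ℝ) * π p.1 p.2) = β

/-- `Ψ = (1/λ) · max_{z ∈ Z} ∑_{y ≠ z} μ(z,y)`. -/
noncomputable def Psi [Fintype Z] [DecidableEq Z] [Nonempty Z]
    (μ : Z → Z → ℝ) (lam : ℝ) : ℝ :=
  (1 / lam) * Finset.univ.sup' Finset.univ_nonempty
    (fun z : Z => ∑ y ∈ Finset.univ.filter (fun y => y ≠ z), μ z y)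

/-- inflow minus outflow at a state -/
noncomputable def netFlow {Z : Type} [Fintype Z] [DecidableEq Z] (μ : Z → Z → ℝ) (lam γ κ : ℝ)
    (ξ : Z → ℕ → ℝ) (u : Z → ℕ → ℝ) (x : Z) (m : ℕ) : ℝ :=
  ((∑ z ∈ Finset.univ.filter (fun z => z ≠ x), u z m * μ z x)
        + κ * (if 1 ≤ m then u x (m - 1) else 0)
        + lam * (m + 1) * (1 - γ * ξ x (m + 1)) * u x (m + 1))
  - u x m * ((∑ y ∈ Finset.univ.filter (fun y => y ≠ x), μ x y) + κ
        + lam * m * (1 - γ * ξ x m))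

/-- flux from level `m+1` down minus flux up from level `m` -/
noncomputable def levelFlux {Z : Type} [Fintype Z] (lam γ κ : ℝ)
    (ξ : Z → ℕ → ℝ) (u : Z → ℕ → ℝ) (m : ℕ) : ℝ :=
  (∑ x, lam * (m + 1) * (1 - γ * ξ x (m + 1)) * u x (m + 1)) - κ * ∑ x, u x m

lemma sum_swap_flow {Z : Type} [Fintype Z] [DecidableEq Z] (μ : Z → Z → ℝ) (v : Z → ℝ) :
    ∑ x, ∑ z ∈ Finset.univ.filter (fun z => z ≠ x), v z * μ z x
      = ∑ x, v x * ∑ y ∈ Finset.univ.filter (fun y => y ≠ x), μ x y := by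
  simp_rw [Finset.mul_sum, Finset.sum_filter]
  rw [Finset.sum_comm]
  refine Finset.sum_congr rfl fun x _ => Finset.sum_congr rfl fun y _ => ?_
  simp only [ne_comm]

lemma sum_netFlow_zero {Z : Type} [Fintype Z] [DecidableEq Z] (μ : Z → Z → ℝ) (lam γ κ : ℝ)
    (ξ : Z → ℕ → ℝ) (u : Z → ℕ → ℝ) :
    ∑ x, netFlow μ lam γ κ ξ u x 0 = levelFlux lam γ κ ξ u 0 := by
  have h := sum_swap_flow μ (fun z => u z 0)
  simp only [netFlow, levelFlux, mul_add, Finset.sum_sub_distrib, Finset.sum_add_distrib, h]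
  simp [Finset.mul_sum, mul_comm]

lemma sum_netFlow_succ {Z : Type} [Fintype Z] [DecidableEq Z] (μ : Z → Z → ℝ) (lam γ κ : ℝ)
    (ξ : Z → ℕ → ℝ) (u : Z → ℕ → ℝ) (m : ℕ) :
    ∑ x, netFlow μ lam γ κ ξ u x (m + 1)
      = levelFlux lam γ κ ξ u (m + 1) - levelFlux lam γ κ ξ u m := by
  have h := sum_swap_flow μ (fun z => u z (m + 1))
  have e : ∀ x, netFlow μ lam γ κ ξ u x (m + 1) =
      (∑ z ∈ Finset.univ.filter (fun z => z ≠ x), u z (m + 1) * μ z x)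
      - u x (m + 1) * (∑ y ∈ Finset.univ.filter (fun y => y ≠ x), μ x y)
      + ((lam * (((m + 1 : ℕ) : ℝ) + 1) * (1 - γ * ξ x (m + 1 + 1)) * u x (m + 1 + 1))
        - κ * u x (m + 1))
      - ((lam * ((m : ℝ) + 1) * (1 - γ * ξ x (m + 1)) * u x (m + 1)) - κ * u x m) := by
    intro x
    simp only [netFlow, if_pos (Nat.le_add_left 1 m), Nat.add_sub_cancel]
    push_cast
    ring
  simp_rw [e]
  simp only [levelFlux, Finset.sum_sub_distrib, Finset.sum_add_distrib, h, Finset.mul_sum]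
  ring

lemma netFlow_eq_zero {Z : Type} [Fintype Z] [DecidableEq Z] {μ : Z → Z → ℝ} {lam γ κ : ℝ}
    {ξ : Z → ℕ → ℝ} {u : Z → ℕ → ℝ} (h : Balance μ lam γ κ ξ u) (x : Z) (m : ℕ) :
    netFlow μ lam γ κ ξ u x m = 0 := by
  unfold netFlow; rw [h x m]; ring

lemma levelFlux_eq_zero {Z : Type} [Fintype Z] [DecidableEq Z] {μ : Z → Z → ℝ} {lam γ κ : ℝ}
    {ξ : Z → ℕ → ℝ} {u : Z → ℕ → ℝ} (h : Balance μ lam γ κ ξ u) (m : ℕ) :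
    levelFlux lam γ κ ξ u m = 0 := by
  induction m with
  | zero => rw [← sum_netFlow_zero μ]; simp [netFlow_eq_zero h]
  | succ m ih =>
    have := sum_netFlow_succ μ lam γ κ ξ u m
    simp [netFlow_eq_zero h, ih] at this
    exact this.symm

/-- a nonnegative sub-solution with decaying flux is a solution -/
lemma netFlow_zero_of_nonneg {Z : Type} [Fintype Z] [DecidableEq Z] {μ : Z → Z → ℝ}
    {lam γ κ : ℝ} {ξ : Z → ℕ → ℝ} {u : Z → ℕ → ℝ}
    (h : ∀ x m, 0 ≤ netFlow μ lam γ κ ξ u x m)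
    (hlim : Filter.Tendsto (levelFlux lam γ κ ξ u) Filter.atTop (nhds 0)) (x : Z) (m : ℕ) :
    netFlow μ lam γ κ ξ u x m = 0 := by
  have hs : ∀ m, 0 ≤ ∑ x, netFlow μ lam γ κ ξ u x m := fun m =>
    Finset.sum_nonneg fun x _ => h x m
  have hmono : Monotone (levelFlux lam γ κ ξ u) := monotone_nat_of_le_succ fun m => by
    have := hs (m + 1); rw [sum_netFlow_succ] at this; linarith
  have hle : ∀ m, levelFlux lam γ κ ξ u m ≤ 0 := fun m => hmono.ge_of_tendsto hlim m
  have h0 : 0 ≤ levelFlux lam γ κ ξ u 0 := by rw [← sum_netFlow_zero μ]; exact hs 0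
  have hz : ∀ m, levelFlux lam γ κ ξ u m = 0 := fun m =>
    le_antisymm (hle m) (h0.trans (hmono (Nat.zero_le m)))
  have hsum : ∑ x, netFlow μ lam γ κ ξ u x m = 0 := by
    cases m with
    | zero => rw [sum_netFlow_zero, hz]
    | succ m => rw [sum_netFlow_succ, hz, hz, sub_zero]
  exact (Finset.sum_eq_zero_iff_of_nonneg fun x _ => h x m).1 hsum x (Finset.mem_univ x)

lemma one_sub_pos {γ a : ℝ} (hγ : γ ∈ Set.Ioo (0 : ℝ) 1) (ha : 0 ≤ a ∧ a ≤ 1) :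
    1 - γ ≤ 1 - γ * a ∧ 1 - γ * a ≤ 1 ∧ 0 < 1 - γ * a := by
  obtain ⟨h1, h2⟩ := hγ
  have : γ * a ≤ γ := by nlinarith [ha.2]
  have : 0 ≤ γ * a := mul_nonneg h1.le ha.1
  refine ⟨?_, ?_, ?_⟩ <;> linarith

/-- irreducibility -/
lemma zero_of_zero {Z : Type} [Fintype Z] [DecidableEq Z] {μ : Z → Z → ℝ}
    (hμ : ∀ z y : Z, z ≠ y → 0 < μ z y)
    {lam γ κ : ℝ} (hlam : 0 < lam) (hγ : γ ∈ Set.Ioo (0 : ℝ) 1) (hκ : 0 < κ)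
    {ξ : Z → ℕ → ℝ} (hξ : IsStrategy ξ) {u : Z → ℕ → ℝ} (hu : ∀ x m, 0 ≤ u x m)
    (h : ∀ x m, netFlow μ lam γ κ ξ u x m = 0) {x₀ : Z} {m₀ : ℕ} (h0 : u x₀ m₀ = 0) :
    ∀ x m, u x m = 0 := by
  have key : ∀ x m, u x m = 0 →
      (∀ z, u z m = 0) ∧ (1 ≤ m → u x (m - 1) = 0) ∧ u x (m + 1) = 0 := by
    intro x m hx
    have hh := h x m
    simp only [netFlow, hx, zero_mul, sub_zero] at hh
    have hA' : ∀ z ∈ Finset.univ.filter (fun z => z ≠ x), 0 ≤ u z m * μ z x := fun z hz =>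
      mul_nonneg (hu _ _) (hμ z x (by simpa using hz)).le
    have hA := Finset.sum_nonneg hA'
    have hB : 0 ≤ κ * (if 1 ≤ m then u x (m - 1) else 0) := by
      apply mul_nonneg hκ.le; split_ifs
      · exact hu _ _
      · exact le_rfl
    have hpos : 0 < lam * ((m : ℝ) + 1) * (1 - γ * ξ x (m + 1)) :=
      mul_pos (by positivity) (one_sub_pos hγ (hξ _ _)).2.2
    have hC := mul_nonneg hpos.le (hu x (m + 1))
    refine ⟨fun z => ?_, fun hm => ?_, ?_⟩
    · by_cases hzx : z = x
      · rw [hzx, hx]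
      · have hz := (Finset.sum_eq_zero_iff_of_nonneg hA').1 (by linarith) z (by simpa using hzx)
        exact (mul_eq_zero.1 hz).resolve_right (hμ z x hzx).ne'
    · have : κ * (if 1 ≤ m then u x (m - 1) else 0) = 0 := by linarith
      rw [if_pos hm] at this
      exact (mul_eq_zero.1 this).resolve_left hκ.ne'
    · have : lam * ((m : ℝ) + 1) * (1 - γ * ξ x (m + 1)) * u x (m + 1) = 0 := by linarith
      exact (mul_eq_zero.1 this).resolve_left hpos.ne'
  have down : ∀ m, u x₀ m = 0 → u x₀ 0 = 0 := by
    intro m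
    induction m with
    | zero => exact id
    | succ m ih => intro hm; exact ih ((key _ _ hm).2.1 (by omega))
  have up : ∀ m, u x₀ m = 0 := by
    intro m
    induction m with
    | zero => exact down _ h0
    | succ m ih => exact (key _ _ ih).2.2
  exact fun x m => (key _ _ (up m)).1 x

/-- The dominating tail. -/
noncomputable def tailB (c : ℝ) (n : ℕ) : ℝ := (2 * c) ^ n / (n.factorial : ℝ)

lemma prob_tail {Z : Type} [Fintype Z] [DecidableEq Z] {μ : Z → Z → ℝ}
    {lam γ κ β : ℝ} (hlam : 0 < lam) (hγ : γ ∈ Set.Ioo (0 : ℝ) 1) (hβ : 0 < β)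
    (hκ : 0 ≤ κ) (hκ2 : κ ≤ β * lam)
    {ξ : Z → ℕ → ℝ} (hξ : IsStrategy ξ) {π : Z → ℕ → ℝ}
    (hπ : IsProbSolution μ lam γ κ ξ π) (x : Z) (m : ℕ) :
    π x m ≤ tailB (β / (1 - γ)) m ∧ (m : ℝ) * π x m ≤ tailB (β / (1 - γ)) m := by
  obtain ⟨hn, hsm, hs1, hb⟩ := hπ
  have hg : 0 < 1 - γ := by linarith [hγ.2]
  set c := β / (1 - γ) with hc
  have hc0 : 0 < c := div_pos hβ hg
  have hP : ∀ m : ℕ, ∑ x, π x m ≤ c ^ m / (m.factorial : ℝ) := by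
    intro m
    induction m with
    | zero =>
      simp only [pow_zero, Nat.factorial_zero, Nat.cast_one, div_one]
      rw [← hs1]
      have h1 : ∑ x, π x 0 = ∑ p ∈ Finset.univ.map ⟨fun x : Z => (x, (0 : ℕ)), fun a b hab => by
          simpa using hab⟩, π p.1 p.2 := by
        rw [Finset.sum_map]; rfl
      rw [h1]
      exact hsm.sum_le_tsum _ fun p _ => hn _ _
    | succ m ih =>
      have hJ := levelFlux_eq_zero hb m
      unfold levelFlux at hJ
      have hlow : lam * (m + 1) * (1 - γ) * ∑ x, π x (m + 1)
          ≤ ∑ x, lam * (m + 1) * (1 - γ * ξ x (m + 1)) * π x (m + 1) := by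
        rw [Finset.mul_sum]
        refine Finset.sum_le_sum fun x _ => mul_le_mul_of_nonneg_right ?_ (hn _ _)
        exact mul_le_mul_of_nonneg_left (one_sub_pos hγ (hξ _ _)).1 (by positivity)
      have hPm : 0 ≤ ∑ x, π x m := Finset.sum_nonneg fun x _ => hn _ _
      have h2 : κ * ∑ x, π x m ≤ β * lam * (c ^ m / (m.factorial : ℝ)) :=
        mul_le_mul hκ2 ih hPm (by positivity)
      have h3 : lam * (m + 1) * (1 - γ) * ∑ x, π x (m + 1)
          ≤ lam * (m + 1) * (1 - γ) * (c ^ (m + 1) / ((m + 1).factorial : ℝ)) := by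
        have : lam * (m + 1) * (1 - γ) * (c ^ (m + 1) / ((m + 1).factorial : ℝ))
            = β * lam * (c ^ m / (m.factorial : ℝ)) := by
          have hcb : c * (1 - γ) = β := by rw [hc]; field_simp
          rw [← hcb, Nat.factorial_succ, pow_succ]
          have : (m.factorial : ℝ) ≠ 0 := by positivity
          push_cast
          field_simp
        linarith
      exact le_of_mul_le_mul_left h3 (by positivity)
  have hx : π x m ≤ c ^ m / (m.factorial : ℝ) :=
    (Finset.single_le_sum (f := fun x => π x m) (fun y _ => hn y m) (Finset.mem_univ x)).trans (hP m)
  have h2m : (m : ℝ) ≤ 2 ^ m := by exact_mod_cast Nat.lt_two_pow_self.le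
  have h1m : (1 : ℝ) ≤ 2 ^ m := one_le_pow₀ (by norm_num)
  have e : tailB c m = 2 ^ m * (c ^ m / (m.factorial : ℝ)) := by
    unfold tailB; rw [mul_pow]; ring
  have hq : 0 ≤ c ^ m / (m.factorial : ℝ) := by positivity
  rw [e]
  constructor
  · nlinarith
  · exact mul_le_mul h2m hx (hn _ _) (by positivity)

lemma summable_tail (c : ℝ) : Summable (tailB c) := Real.summable_pow_div_factorial _

lemma summable_tail_prod {Z : Type} [Fintype Z] (c : ℝ) (hc : 0 ≤ c) :
    Summable (fun p : Z × ℕ => tailB c p.2) := by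
  have h := Summable.mul_of_nonneg (f := fun _ : Z => (1 : ℝ)) (g := tailB c)
    (Summable.of_finite) (summable_tail c) (fun _ => zero_le_one)
    (fun n => by unfold tailB; positivity)
  simpa using h

/-- Uniqueness, given decay. -/
lemma prob_le {Z : Type} [Fintype Z] [DecidableEq Z] [Nonempty Z] {μ : Z → Z → ℝ}
    (hμ : ∀ z y : Z, z ≠ y → 0 < μ z y)
    {lam γ κ β : ℝ} (hlam : 0 < lam) (hγ : γ ∈ Set.Ioo (0 : ℝ) 1) (hβ : 0 < β)
    (hκ : 0 < κ) (hκ2 : κ ≤ β * lam)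
    {ξ : Z → ℕ → ℝ} (hξ : IsStrategy ξ) {π ρ : Z → ℕ → ℝ}
    (hπ : IsProbSolution μ lam γ κ ξ π) (hρ : IsProbSolution μ lam γ κ ξ ρ) :
    ∀ x m, π x m ≤ ρ x m := by
  have hc0 : 0 < β / (1 - γ) := div_pos hβ (by linarith [hγ.2])
  have htail := prob_tail hlam hγ hβ hκ.le hκ2 hξ hπ
  set c := β / (1 - γ)
  obtain ⟨hn, hsm, hs1, hb⟩ := hπ
  obtain ⟨hn', hsm', hs1', hb'⟩ := hρ
  let u : Z → ℕ → ℝ := fun x m => max (π x m - ρ x m) 0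
  have hu : ∀ x m, 0 ≤ u x m := fun x m => le_max_right _ _
  have hud : ∀ x m, π x m - ρ x m ≤ u x m := fun x m => le_max_left _ _
  have huπ : ∀ x m, u x m ≤ π x m := fun x m =>
    max_le (by linarith [hn' x m]) (hn x m)
  have hmu0 : ∀ x z : Z, z ∈ Finset.univ.filter (fun z => z ≠ x) → 0 ≤ μ z x := fun x z hz =>
    (hμ z x (by simpa using hz)).le
  have hpos : ∀ x (m : ℕ), 0 < lam * ((m : ℝ) + 1) * (1 - γ * ξ x (m + 1)) := fun x m =>
      mul_pos (by positivity) (one_sub_pos hγ (hξ _ _)).2.2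
  have hnet : ∀ x m, 0 ≤ netFlow μ lam γ κ ξ u x m := by
    intro x m
    have hA : ∑ z ∈ Finset.univ.filter (fun z => z ≠ x), π z m * μ z x
        - ∑ z ∈ Finset.univ.filter (fun z => z ≠ x), ρ z m * μ z x
        ≤ ∑ z ∈ Finset.univ.filter (fun z => z ≠ x), u z m * μ z x := by
      rw [← Finset.sum_sub_distrib]
      refine Finset.sum_le_sum fun z hz => ?_
      rw [← sub_mul]
      exact mul_le_mul_of_nonneg_right (hud _ _) (hmu0 x z hz)
    have hA0 : 0 ≤ ∑ z ∈ Finset.univ.filter (fun z => z ≠ x), u z m * μ z x :=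
      Finset.sum_nonneg fun z hz => mul_nonneg (hu _ _) (hmu0 x z hz)
    have hB : κ * (if 1 ≤ m then π x (m - 1) else 0) - κ * (if 1 ≤ m then ρ x (m - 1) else 0)
        ≤ κ * (if 1 ≤ m then u x (m - 1) else 0) := by
      rw [← mul_sub]
      apply mul_le_mul_of_nonneg_left _ hκ.le
      split_ifs
      · exact hud _ _
      · simp
    have hB0 : 0 ≤ κ * (if 1 ≤ m then u x (m - 1) else 0) := by
      apply mul_nonneg hκ.le
      split_ifs
      · exact hu _ _
      · exact le_rfl
    have hC := mul_le_mul_of_nonneg_left (hud x (m + 1)) (hpos x m).le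
    have hC0 := mul_nonneg (hpos x m).le (hu x (m + 1))
    have e1 := hb x m
    have e2 := hb' x m
    unfold netFlow
    rcases le_total (π x m - ρ x m) 0 with hd | hd
    · have : u x m = 0 := max_eq_right hd
      rw [this]; linarith
    · have : u x m = π x m - ρ x m := max_eq_left hd
      rw [this, sub_mul, e1, e2]; rw [mul_sub] at hC; linarith
  have hlim : Filter.Tendsto (levelFlux lam γ κ ξ u) Filter.atTop (nhds 0) := by
    have hT := (summable_tail c).tendsto_atTop_zero
    have hT1 : Filter.Tendsto (fun m => tailB c (m + 1)) Filter.atTop (nhds 0) :=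
      (Filter.tendsto_add_atTop_iff_nat 1).2 hT
    have h1 : ∀ x, Filter.Tendsto (fun m : ℕ =>
        lam * ((m : ℝ) + 1) * (1 - γ * ξ x (m + 1)) * u x (m + 1)) Filter.atTop (nhds 0) := by
      intro x
      refine squeeze_zero (fun m => mul_nonneg (hpos x m).le (hu _ _)) (fun m => ?_)
        (by simpa using hT1.const_mul lam)
      have h2 := (htail x (m + 1)).2
      push_cast at h2
      have h3 := (one_sub_pos hγ (hξ x (m + 1)))
      calc lam * ((m : ℝ) + 1) * (1 - γ * ξ x (m + 1)) * u x (m + 1)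
          ≤ lam * ((m : ℝ) + 1) * 1 * π x (m + 1) := by
            apply mul_le_mul _ (huπ _ _) (hu _ _) (by positivity)
            exact mul_le_mul_of_nonneg_left h3.2.1 (by positivity)
        _ = lam * (((m : ℝ) + 1) * π x (m + 1)) := by ring
        _ ≤ _ := mul_le_mul_of_nonneg_left h2 hlam.le
    have h2 : ∀ x, Filter.Tendsto (fun m : ℕ => u x m) Filter.atTop (nhds 0) := fun x =>
      squeeze_zero (fun m => hu _ _) (fun m => (huπ x m).trans (htail x m).1) hT
    have h3 := (tendsto_finsetSum Finset.univ fun x _ => h1 x).sub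
      ((tendsto_finsetSum Finset.univ fun x _ => h2 x).const_mul κ)
    simp only [Finset.sum_const_zero, mul_zero, sub_zero] at h3
    exact h3
  have hz := netFlow_zero_of_nonneg hnet hlim
  by_contra! hcon
  obtain ⟨x₁, m₁, h₁⟩ := hcon
  have hall : ∀ x m, ρ x m < π x m := by
    intro x m
    by_contra! hle
    have h0 : u x m = 0 := max_eq_right (by linarith)
    have := zero_of_zero hμ hlam hγ hκ hξ hu hz h0 x₁ m₁
    have := hud x₁ m₁
    linarith
  have := Summable.tsum_lt_tsum (f := fun p : Z × ℕ => ρ p.1 p.2)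
    (g := fun p : Z × ℕ => π p.1 p.2) (i := (x₁, m₁)) (fun p => (hall _ _).le) (hall _ _) hsm' hsm
  linarith

lemma exists_ultralim (U : Ultrafilter ℕ) {a b : ℝ} (f : ℕ → ℝ) (hf : ∀ n, f n ∈ Set.Icc a b) :
    ∃ l ∈ Set.Icc a b, Filter.Tendsto f (U : Filter ℕ) (nhds l) := by
  obtain ⟨l, hl, h⟩ := (isCompact_Icc (a := a) (b := b)).ultrafilter_le_nhds (U.map f)
    (by
      rw [Filter.le_principal_iff]
      exact Filter.mem_map.2 (Filter.Eventually.of_forall hf))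
  exact ⟨l, hl, h⟩

/-- Limits of solutions are solutions, and their means converge. -/
lemma limit_solution {Z : Type} [Fintype Z] [DecidableEq Z] {μ : Z → Z → ℝ}
    {lam γ β : ℝ} (hlam : 0 < lam) (hγ : γ ∈ Set.Ioo (0 : ℝ) 1) (hβ : 0 < β)
    (U : Ultrafilter ℕ) (ξ : ℕ → Z → ℕ → ℝ) (κ : ℕ → ℝ) (π : ℕ → Z → ℕ → ℝ)
    (hξ : ∀ n, IsStrategy (ξ n)) (hκ : ∀ n, 0 ≤ κ n) (hκ2 : ∀ n, κ n ≤ β * lam)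
    (hπ : ∀ n, IsProbSolution μ lam γ (κ n) (ξ n) (π n))
    (ξ' : Z → ℕ → ℝ) (κ' : ℝ)
    (hξl : ∀ x m, Filter.Tendsto (fun n => ξ n x m) (U : Filter ℕ) (nhds (ξ' x m)))
    (hκl : Filter.Tendsto κ (U : Filter ℕ) (nhds κ')) :
    ∃ π' : Z → ℕ → ℝ, IsProbSolution μ lam γ κ' ξ' π' ∧
      Filter.Tendsto (fun n => ∑' p : Z × ℕ, (p.2 : ℝ) * π n p.1 p.2) (U : Filter ℕ)
        (nhds (∑' p : Z × ℕ, (p.2 : ℝ) * π' p.1 p.2)) := by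
  have hc0 : 0 < β / (1 - γ) := div_pos hβ (by linarith [hγ.2])
  have htail := fun n => prob_tail hlam hγ hβ (hκ n) (hκ2 n) (hξ n) (hπ n)
  set c := β / (1 - γ)
  have hS := summable_tail_prod (Z := Z) c hc0.le
  have hex : ∀ x m, ∃ l ∈ Set.Icc 0 (tailB c m),
      Filter.Tendsto (fun n => π n x m) (U : Filter ℕ) (nhds l) := fun x m =>
    exists_ultralim U _ fun n => ⟨(hπ n).1 x m, (htail n x m).1⟩
  choose π' hmem hlim using hex
  have hsum' : Summable (fun p : Z × ℕ => π' p.1 p.2) :=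
    Summable.of_nonneg_of_le (fun p => (hmem _ _).1) (fun p => (hmem _ _).2) hS
  refine ⟨π', ⟨fun z n => (hmem z n).1, hsum', ?_, ?_⟩, ?_⟩
  · have h := tendsto_tsum_of_dominated_convergence (𝓕 := (U : Filter ℕ))
      (f := fun n (p : Z × ℕ) => π n p.1 p.2)
      (g := fun p : Z × ℕ => π' p.1 p.2) hS (fun p => hlim _ _)
      (Filter.Eventually.of_forall fun n p => by
        rw [Real.norm_of_nonneg ((hπ n).1 _ _)]; exact (htail n _ _).1)
    have h1 : (fun n => ∑' p : Z × ℕ, π n p.1 p.2) = fun _ => 1 := funext fun n => (hπ n).2.2.1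
    rw [h1] at h
    exact tendsto_nhds_unique h tendsto_const_nhds
  · intro x m
    have hL : Filter.Tendsto (fun n => π n x m *
        ((∑ y ∈ Finset.univ.filter (fun y => y ≠ x), μ x y) + κ n
          + lam * m * (1 - γ * ξ n x m))) (U : Filter ℕ)
        (nhds (π' x m * ((∑ y ∈ Finset.univ.filter (fun y => y ≠ x), μ x y) + κ'
          + lam * m * (1 - γ * ξ' x m)))) :=
      (hlim x m).mul ((hκl.const_add _).add
        ((((hξl x m).const_mul γ).const_sub 1).const_mul _))
    have hI : Filter.Tendsto (fun n => if 1 ≤ m then π n x (m - 1) else 0) (U : Filter ℕ)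
        (nhds (if 1 ≤ m then π' x (m - 1) else 0)) := by
      split_ifs
      · exact hlim _ _
      · exact tendsto_const_nhds
    have hR : Filter.Tendsto (fun n =>
        (∑ z ∈ Finset.univ.filter (fun z => z ≠ x), π n z m * μ z x)
        + κ n * (if 1 ≤ m then π n x (m - 1) else 0)
        + lam * (m + 1) * (1 - γ * ξ n x (m + 1)) * π n x (m + 1)) (U : Filter ℕ)
        (nhds ((∑ z ∈ Finset.univ.filter (fun z => z ≠ x), π' z m * μ z x)
        + κ' * (if 1 ≤ m then π' x (m - 1) else 0)
        + lam * (m + 1) * (1 - γ * ξ' x (m + 1)) * π' x (m + 1))) :=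
      ((tendsto_finsetSum _ fun z _ => (hlim z m).mul_const _).add (hκl.mul hI)).add
        (((((hξl x (m + 1)).const_mul γ).const_sub 1).const_mul _).mul (hlim _ _))
    refine tendsto_nhds_unique hL (hR.congr fun n => ?_)
    exact ((hπ n).2.2.2 x m).symm
  · exact tendsto_tsum_of_dominated_convergence (𝓕 := (U : Filter ℕ))
      (f := fun n (p : Z × ℕ) => (p.2 : ℝ) * π n p.1 p.2)
      (g := fun p : Z × ℕ => (p.2 : ℝ) * π' p.1 p.2) hS (fun p => (hlim _ _).const_mul _)
      (Filter.Eventually.of_forall fun n p => by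
        rw [Real.norm_of_nonneg (mul_nonneg (Nat.cast_nonneg _) ((hπ n).1 _ _))]
        exact (htail n _ _).2)

/-- **Joint uniform continuity of the mean number of agents** (Lemma 7 of the
paper): `φ(ξ,κ) = ∑ n·π(ξ,κ)(z,n)` is jointly and uniformly continuous on
(strategies with the sup-norm) × `[βλ(1-γ), βλ]`. -/
theorem phi_uniformly_continuous (Z : Type) [Fintype Z] [DecidableEq Z] [Nonempty Z]
    (μ : Z → Z → ℝ) (hμ : ∀ z y : Z, z ≠ y → 0 < μ z y)
    (lam γ β : ℝ) (hlam : 0 < lam) (hγ : γ ∈ Set.Ioo (0 : ℝ) 1) (hβ : 0 < β) :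
    ∀ ε : ℝ, 0 < ε → ∃ δ : ℝ, 0 < δ ∧
      ∀ (ξ₁ ξ₂ : Z → ℕ → ℝ) (κ₁ κ₂ : ℝ) (π₁ π₂ : Z → ℕ → ℝ),
        IsStrategy ξ₁ → IsStrategy ξ₂ →
        κ₁ ∈ Set.Icc (β * lam * (1 - γ)) (β * lam) →
        κ₂ ∈ Set.Icc (β * lam * (1 - γ)) (β * lam) →
        IsProbSolution μ lam γ κ₁ ξ₁ π₁ →
        IsProbSolution μ lam γ κ₂ ξ₂ π₂ →
        (⨆ p : Z × ℕ, |ξ₁ p.1 p.2 - ξ₂ p.1 p.2|) < δ →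
        |κ₁ - κ₂| < δ →
        |(∑' p : Z × ℕ, (p.2 : ℝ) * π₁ p.1 p.2)
          - (∑' p : Z × ℕ, (p.2 : ℝ) * π₂ p.1 p.2)| < ε := by
  by_contra! hcon
  obtain ⟨ε, hε, H⟩ := hcon
  have H' := fun n : ℕ => H (1 / ((n : ℝ) + 1)) (by positivity)
  choose ξ₁ ξ₂ κ₁ κ₂ π₁ π₂ hξ₁ hξ₂ hκ₁ hκ₂ hπ₁ hπ₂ hξd hκd hfar using H'
  have hlow : 0 < β * lam * (1 - γ) := mul_pos (mul_pos hβ hlam) (by linarith [hγ.2])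
  let U : Ultrafilter ℕ := Filter.hyperfilter ℕ
  have hU : (U : Filter ℕ) ≤ Filter.atTop := by
    rw [← Nat.cofinite_eq_atTop]; exact Filter.hyperfilter_le_cofinite
  have hδ : Filter.Tendsto (fun n : ℕ => 1 / ((n : ℝ) + 1)) (U : Filter ℕ) (nhds 0) :=
    tendsto_one_div_add_atTop_nhds_zero_nat.mono_left hU
  have hex : ∀ x m, ∃ l ∈ Set.Icc (0 : ℝ) 1,
      Filter.Tendsto (fun n => ξ₁ n x m) (U : Filter ℕ) (nhds l) := fun x m =>
    exists_ultralim U _ fun n => hξ₁ n x m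
  choose ξ' hξm hξl using hex
  obtain ⟨κ', hκm, hκl⟩ := exists_ultralim U κ₁ hκ₁
  have hξl2 : ∀ x m, Filter.Tendsto (fun n => ξ₂ n x m) (U : Filter ℕ) (nhds (ξ' x m)) := by
    intro x m
    have hd : Filter.Tendsto (fun n => ξ₁ n x m - ξ₂ n x m) (U : Filter ℕ) (nhds 0) := by
      refine squeeze_zero_norm (fun n => ?_) hδ
      refine le_trans ?_ (hξd n).le
      have hbdd : BddAbove (Set.range fun p : Z × ℕ => |ξ₁ n p.1 p.2 - ξ₂ n p.1 p.2|) := by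
        refine ⟨1, ?_⟩
        rintro _ ⟨p, rfl⟩
        have h1 := hξ₁ n p.1 p.2
        have h2 := hξ₂ n p.1 p.2
        exact abs_le.2 ⟨by linarith [h1.1, h2.2], by linarith [h1.2, h2.1]⟩
      exact le_ciSup hbdd (x, m)
    simpa using (hξl x m).sub hd
  have hκl2 : Filter.Tendsto κ₂ (U : Filter ℕ) (nhds κ') := by
    have hd : Filter.Tendsto (fun n => κ₁ n - κ₂ n) (U : Filter ℕ) (nhds 0) :=
      squeeze_zero_norm (fun n => (hκd n).le) hδ
    simpa using hκl.sub hd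
  obtain ⟨ρ₁, hρ₁, hm₁⟩ := limit_solution hlam hγ hβ U ξ₁ κ₁ π₁ hξ₁
    (fun n => hlow.le.trans (hκ₁ n).1) (fun n => (hκ₁ n).2) hπ₁ ξ' κ' hξl hκl
  obtain ⟨ρ₂, hρ₂, hm₂⟩ := limit_solution hlam hγ hβ U ξ₂ κ₂ π₂ hξ₂
    (fun n => hlow.le.trans (hκ₂ n).1) (fun n => (hκ₂ n).2) hπ₂ ξ' κ' hξl2 hκl2
  have hκ0 : 0 < κ' := hlow.trans_le hκm.1
  have heq : ρ₁ = ρ₂ := by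
    funext x m
    exact le_antisymm (prob_le hμ hlam hγ hβ hκ0 hκm.2 hξm hρ₁ hρ₂ x m)
      (prob_le hμ hlam hγ hβ hκ0 hκm.2 hξm hρ₂ hρ₁ x m)
  subst heq
  have hlim := (hm₁.sub hm₂).abs
  rw [sub_self, abs_zero] at hlim
  have := ge_of_tendsto' hlim hfar
  linarith
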